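/- arXiv:1906.05877 — 2 statements merged into one kernel-verified Lean document; each statement's English description precedes it below -/
import Mathlib

section
/- Let γ: [0,1] → ℝ^n be a non-degenerate C^n curve. Then there exist constants δ_0 = δ_0(γ,n) ≤ 1 and c_0 = c_0(γ,n) ≥ 10 such that the following holds. Let R ≥ 1 be an integer and let 𝓘 be any set of intervals from the dissection of [0,1] into intervals of length R^{-1} such that dist(I,I') ≥ c_0·R^{-1} for all distinct I, I' ∈ 𝓘, and diam(⋃_{I∈𝓘} I) ≤ δ_0. Then for any intervals I_1,...,I_n, I_1',...,I_n' ∈ 𝓘 such that the tuple (I_1,...,I_n) is not a permutation of (I_1',...,I_n'), and for any points t_i ∈ I_i and s_i ∈ I_i' (1 ≤ i ≤ n), one has |∑_{i=1}^n (γ(t_i) − γ(s_i))| ≥ R^{-n}. -/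
open MeasureTheory Finset

noncomputable section

/-- Non-degeneracy of a `C^n` curve `γ : [0,1] → ℝ^n`:
`det(γ'(t), γ''(t), …, γ^{(n)}(t)) ≠ 0` for every `t ∈ [0,1]`. -/
def NonDegenerate (n : ℕ) (γ : ℝ → EuclideanSpace ℝ (Fin n)) : Prop :=
  ∀ t ∈ Set.Icc (0 : ℝ) 1,
    (Matrix.of fun (i j : Fin n) =>
      iteratedDerivWithin ((j : ℕ) + 1) γ (Set.Icc 0 1) t i).det ≠ 0

/-- Rolle's theorem, iterated along a chain `D 0, D 1, …, D m` of successive derivatives. -/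
lemma exists_eq_zero_of_strictMono_zeros {a b : ℝ} (m : ℕ) (D : ℕ → ℝ → ℝ)
    (hD : ∀ j < m, ∀ x ∈ Set.Icc a b, HasDerivWithinAt (D j) (D (j + 1) x) (Set.Icc a b) x)
    (z : Fin (m + 1) → ℝ) (hz : StrictMono z) (hmem : ∀ i, z i ∈ Set.Icc a b)
    (hzero : ∀ i, D 0 (z i) = 0) : ∃ x ∈ Set.Icc a b, D m x = 0 := by
  induction m generalizing D with
  | zero => exact ⟨z 0, hmem 0, hzero 0⟩
  | succ m ih =>
    have key : ∀ i : Fin (m + 1), ∃ y ∈ Set.Ioo (z i.castSucc) (z i.succ), D 1 y = 0 := by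
      intro i
      have hsub : Set.Icc (z i.castSucc) (z i.succ) ⊆ Set.Icc a b :=
        Set.Icc_subset_Icc (hmem _).1 (hmem _).2
      refine exists_hasDerivAt_eq_zero (f := D 0) (hz i.castSucc_lt_succ) ?_ ?_ ?_
      · exact fun x hx => ((hD 0 (by omega) x (hsub hx)).continuousWithinAt).mono hsub
      · rw [hzero, hzero]
      · intro x hx
        exact (hD 0 (by omega) x (hsub (Set.Ioo_subset_Icc_self hx))).hasDerivAt
          (Icc_mem_nhds ((hmem _).1.trans_lt hx.1) (hx.2.trans_le (hmem _).2))
    choose w hw hw0 using key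
    refine ih (fun j => D (j + 1)) (fun j hj => hD (j + 1) (by omega)) w ?_ ?_ hw0
    · intro i j hij
      exact (hw i).2.trans_le
        ((hz.monotone (Fin.succ_le_castSucc_iff.2 hij)).trans (hw j).1.le)
    · exact fun i => ⟨(hmem _).1.trans (hw i).1.le, (hw i).2.le.trans (hmem _).2⟩

lemma exists_eq_zero_of_card_zeros {a b : ℝ} (m : ℕ) (D : ℕ → ℝ → ℝ)
    (hD : ∀ j < m, ∀ x ∈ Set.Icc a b, HasDerivWithinAt (D j) (D (j + 1) x) (Set.Icc a b) x)
    (Z : Finset ℝ) (hcard : m < #Z) (hmem : ∀ z ∈ Z, z ∈ Set.Icc a b)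
    (hzero : ∀ z ∈ Z, D 0 z = 0) : ∃ x ∈ Set.Icc a b, D m x = 0 := by
  obtain ⟨W, hWZ, hW⟩ := exists_subset_card_eq (Nat.succ_le_of_lt hcard)
  exact exists_eq_zero_of_strictMono_zeros m D hD (W.orderEmbOfFin hW)
    (W.orderEmbOfFin hW).strictMono
    (fun i => hmem _ (hWZ (W.orderEmbOfFin_mem hW i)))
    (fun i => hzero _ (hWZ (W.orderEmbOfFin_mem hW i)))

/-- A function with `m` zeros whose `m`-th derivative is nonnegative has the sign of the
monic polynomial with these zeros. -/
lemma mul_prod_sub_nonneg {a b : ℝ} (D : ℕ → ℝ → ℝ) (Z : Finset ℝ)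
    (hD : ∀ j < #Z, ∀ x ∈ Set.Icc a b, HasDerivWithinAt (D j) (D (j + 1) x) (Set.Icc a b) x)
    (hmem : ∀ z ∈ Z, z ∈ Set.Icc a b) (hzero : ∀ z ∈ Z, D 0 z = 0)
    (hpos : ∀ x ∈ Set.Icc a b, 0 ≤ D #Z x) {u : ℝ} (hu : u ∈ Set.Icc a b) :
    0 ≤ D 0 u * ∏ z ∈ Z, (u - z) := by
  by_cases huZ : u ∈ Z
  · simp [hzero u huZ]
  set P : Polynomial ℝ := ∏ z ∈ Z, (Polynomial.X - Polynomial.C z) with hP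
  have hPeval : ∀ x, P.eval x = ∏ z ∈ Z, (x - z) := fun x => by
    simp [hP, Polynomial.eval_prod]
  rw [← hPeval]
  set E : ℕ → ℝ → ℝ := fun j x =>
    D j x * P.eval u - D 0 u * (Polynomial.derivative^[j] P).eval x with hE
  have hE1 : ∀ j < #Z, ∀ x ∈ Set.Icc a b,
      HasDerivWithinAt (E j) (E (j + 1) x) (Set.Icc a b) x := by
    intro j hj x hx
    refine ((hD j hj x hx).mul_const _).sub (HasDerivWithinAt.const_mul _ ?_)
    rw [Function.iterate_succ_apply']
    exact (Polynomial.hasDerivAt _ _).hasDerivWithinAt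
  have hE2 : ∀ z ∈ insert u Z, z ∈ Set.Icc a b := by
    intro z hz
    rcases mem_insert.1 hz with rfl | hz
    exacts [hu, hmem z hz]
  have hE3 : ∀ z ∈ insert u Z, E 0 z = 0 := by
    intro z hz
    rcases mem_insert.1 hz with rfl | hz
    · simp [hE]
    · have : P.eval z = 0 := by
        rw [hPeval]
        exact prod_eq_zero hz (sub_self z)
      simp [hE, hzero z hz, this]
  obtain ⟨x, hx, hx0⟩ :=
    exists_eq_zero_of_card_zeros #Z E hE1 (insert u Z) (by simp [huZ]) hE2 hE3
  have h1 : D #Z x * P.eval u = D 0 u * (#Z).factorial := by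
    have := Polynomial.iterate_derivative_prod_X_sub_C (S := Z) le_rfl
    simp only [hE, hP, this] at hx0
    simp at hx0
    have hx0' : D #Z x * P.eval u - D 0 u * (#Z).factorial = 0 := hx0
    linarith
  have h2 : (0 : ℝ) < (#Z).factorial := by positivity
  have h3 : (D 0 u * P.eval u) * (#Z).factorial = D #Z x * (P.eval u) ^ 2 := by
    linear_combination (-(P.eval u)) * h1
  have h4 : 0 ≤ D #Z x * (P.eval u) ^ 2 := mul_nonneg (hpos x hx) (sq_nonneg _)
  rw [← h3] at h4
  exact nonneg_of_mul_nonneg_left h4 h2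

/-- A function whose `k`-th derivative is at least `c` cannot be small on an interval. -/
lemma mul_pow_le_of_abs_le {c h : ℝ} (hh : 0 < h) (k : ℕ) {a b : ℝ} (hab : a + k * h ≤ b)
    (D : ℕ → ℝ → ℝ)
    (hD : ∀ j < k, ∀ x ∈ Set.Icc a b, HasDerivWithinAt (D j) (D (j + 1) x) (Set.Icc a b) x)
    (hc : ∀ x ∈ Set.Icc a b, c ≤ D k x) {M : ℝ} (hM : ∀ x ∈ Set.Icc a b, |D 0 x| ≤ M) :
    c * h ^ k ≤ 2 ^ k * M := by
  induction k generalizing b c D M with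
  | zero =>
    have ha : a ∈ Set.Icc a b := ⟨le_rfl, by simpa using hab⟩
    simpa using (hc a ha).trans ((le_abs_self _).trans (hM a ha))
  | succ k ih =>
    push_cast at hab
    have hs : ∀ x ∈ Set.Icc a (b - h), x ∈ Set.Icc a b := fun x hx => ⟨hx.1, by linarith [hx.2]⟩
    have hs' : ∀ x ∈ Set.Icc a (b - h), x + h ∈ Set.Icc a b :=
      fun x hx => ⟨by linarith [hx.1], by linarith [hx.2]⟩
    have := ih (b := b - h) (c := c * h) (M := 2 * M) (by linarith)
      (fun j x => D j (x + h) - D j x) ?_ ?_ ?_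
    · calc c * h ^ (k + 1) = c * h * h ^ k := by ring
        _ ≤ _ := this
        _ = _ := by ring
    · intro j hj x hx
      have h1 := hD j (by omega) _ (hs' x hx)
      have h2 := (hD j (by omega) _ (hs x hx)).mono hs
      refine HasDerivWithinAt.sub ?_ h2
      have := h1.scomp x ((hasDerivWithinAt_id x (Set.Icc a (b - h))).add_const h) hs'
      simpa [Function.comp_def] using this
    · intro x hx
      have hsub : Set.Icc x (x + h) ⊆ Set.Icc a b := Set.Icc_subset_Icc (hs x hx).1 (hs' x hx).2
      obtain ⟨y, hy, hy'⟩ := exists_hasDerivAt_eq_slope (D k) (D (k + 1)) (a := x) (b := x + h)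
        (by linarith)
        (fun y hy => ((hD k (by omega) y (hsub hy)).continuousWithinAt).mono hsub)
        (fun y hy => (hD k (by omega) y (hsub (Set.Ioo_subset_Icc_self hy))).hasDerivAt
          (Icc_mem_nhds ((hs x hx).1.trans_lt hy.1) (hy.2.trans_le (hs' x hx).2)))
      have := hc y (hsub (Set.Ioo_subset_Icc_self hy))
      rw [hy', add_sub_cancel_left, le_div_iff₀ hh] at this
      exact this
    · intro x hx
      have h1 := hM _ (hs x hx)
      have h2 := hM _ (hs' x hx)
      calc |D 0 (x + h) - D 0 x| ≤ |D 0 (x + h)| + |D 0 x| := abs_sub _ _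
        _ ≤ 2 * M := by linarith

/-- The sorted pairs `(s i, t i)` span intervals whose orientations change fewer than `#S` times:
some monic polynomial with fewer than `#S` roots follows these orientations. -/
lemma exists_sign_pattern {ι : Type*} [LinearOrder ι] {t s : ι → ℝ} (ht : Monotone t)
    (hs : Monotone s) (S : Finset ι) :
    (∀ i ∈ S, t i = s i) ∨ ∃ (Z : Finset ℝ) (e : ℝ) (l : ι), l ∈ S ∧ #Z < #S ∧ (e = 1 ∨ e = -1) ∧
      0 < e * (t l - s l) ∧ (∀ i ∈ S, t i ≠ s i → i ≤ l) ∧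
      (∀ z ∈ Z, ∃ i ≤ l, z = min (t i) (s i)) ∧
      ∀ i ∈ S, ∀ u, min (t i) (s i) ≤ u → u ≤ max (t i) (s i) →
        0 ≤ e * (t i - s i) * ∏ z ∈ Z, (u - z) := by
  induction S using Finset.induction_on_max with
  | empty => simp
  | insert a S hlt ih =>
    have haS : a ∉ S := fun h => (hlt a h).false
    have hmin : ∀ i j, i ≤ j → min (t i) (s i) ≤ min (t j) (s j) := fun i j hij =>
      min_le_min (ht hij) (hs hij)
    by_cases hta : t a = s a
    · rcases ih with ih | ⟨Z, e, l, hl, hZ, he, hel, hlast, hZm, hsign⟩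
      · left
        simpa [hta] using ih
      · refine Or.inr ⟨Z, e, l, mem_insert_of_mem hl, by rw [card_insert_of_notMem haS]; omega,
          he, hel, ?_, hZm, ?_⟩
        · intro i hi hne
          rcases mem_insert.1 hi with rfl | hi
          exacts [absurd hta hne, hlast i hi hne]
        · intro i hi u hu1 hu2
          rcases mem_insert.1 hi with rfl | hi
          exacts [by simp [hta], hsign i hi u hu1 hu2]
    right
    have hlast' : ∀ i ∈ insert a S, t i ≠ s i → i ≤ a := by
      intro i hi _
      rcases mem_insert.1 hi with rfl | hi
      exacts [le_rfl, (hlt i hi).le]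
    rcases ih with ih | ⟨Z, e, l, hl, hZ, he, hel, hlast, hZm, hsign⟩
    · obtain ⟨e, he, hea⟩ : ∃ e : ℝ, (e = 1 ∨ e = -1) ∧ 0 < e * (t a - s a) := by
        rcases lt_or_gt_of_ne hta with h | h
        · exact ⟨-1, by simp, by linarith⟩
        · exact ⟨1, by simp, by linarith⟩
      refine ⟨∅, e, a, mem_insert_self _ _, by rw [card_insert_of_notMem haS]; simp, he, hea,
        hlast', by simp, ?_⟩
      intro i hi u _ _
      rcases mem_insert.1 hi with rfl | hi
      · simpa using hea.le
      · simp [ih i hi]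
    have hla : l < a := hlt l hl
    have hZa : ∀ z ∈ Z, z ≤ min (t a) (s a) := by
      intro z hz
      obtain ⟨i, hi, rfl⟩ := hZm z hz
      exact hmin _ _ (hi.trans hla.le)
    by_cases hea : 0 < e * (t a - s a)
    · refine ⟨Z, e, a, mem_insert_self _ _, by rw [card_insert_of_notMem haS]; omega, he, hea,
        hlast', ?_, ?_⟩
      · intro z hz
        obtain ⟨i, hi, h⟩ := hZm z hz
        exact ⟨i, hi.trans hla.le, h⟩
      · intro i hi u hu1 hu2
        rcases mem_insert.1 hi with rfl | hi
        · exact mul_nonneg hea.le (prod_nonneg fun z hz => by linarith [hZa z hz])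
        · exact hsign i hi u hu1 hu2
    · have hea' : 0 < -e * (t a - s a) := by
        have hne : e * (t a - s a) ≠ 0 := by
          refine mul_ne_zero ?_ (sub_ne_zero.2 hta)
          rcases he with rfl | rfl <;> norm_num
        rcases lt_or_gt_of_ne hne with h | h
        · linarith
        · exact absurd h hea
      have hsep : max (t l) (s l) ≤ min (t a) (s a) := by
        have h1 := ht hla.le
        have h2 := hs hla.le
        rcases he with rfl | rfl <;>
          exact max_le (le_min (by linarith) (by linarith)) (le_min (by linarith) (by linarith))
      have hlt_l : min (t l) (s l) < max (t l) (s l) := by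
        rw [min_lt_max]
        intro h
        simp [h] at hel
      have hnot : min (t a) (s a) ∉ Z := by
        intro h
        obtain ⟨i, hi, h⟩ := hZm _ h
        have := hmin i l hi
        linarith
      refine ⟨insert (min (t a) (s a)) Z, -e, a, mem_insert_self _ _, ?_, ?_, hea', hlast', ?_, ?_⟩
      · rw [card_insert_of_notMem haS, card_insert_of_notMem hnot]
        omega
      · rcases he with rfl | rfl <;> simp
      · intro z hz
        rcases mem_insert.1 hz with rfl | hz
        · exact ⟨a, le_rfl, rfl⟩
        · obtain ⟨i, hi, h⟩ := hZm z hz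
          exact ⟨i, hi.trans hla.le, h⟩
      · intro i hi u hu1 hu2
        rw [prod_insert hnot]
        rcases mem_insert.1 hi with rfl | hi
        · exact mul_nonneg hea'.le (mul_nonneg (by linarith)
            (prod_nonneg fun z hz => by linarith [hZa z hz]))
        · by_cases hti : t i = s i
          · simp [hti]
          have hil := hlast i hi hti
          have hu : u ≤ min (t a) (s a) :=
            hu2.trans ((max_le_max (ht hil) (hs hil)).trans hsep)
          have := mul_nonneg (hsign i hi u hu1 hu2) (sub_nonneg.2 hu)
          calc (0 : ℝ) ≤ _ := this
            _ = _ := by ring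

/-- Uniform quantitative form of non-degeneracy. -/
lemma NonDegenerate.exists_pos_le_sum {n : ℕ} {γ : ℝ → EuclideanSpace ℝ (Fin n)}
    (hγ : ContDiffOn ℝ n γ (Set.Icc 0 1)) (hnd : NonDegenerate n γ) :
    ∃ c > 0, ∀ t ∈ Set.Icc (0 : ℝ) 1, ∀ v : EuclideanSpace ℝ (Fin n), ‖v‖ = 1 →
      c ≤ ∑ j : Fin n, |inner ℝ v (iteratedDerivWithin ((j : ℕ) + 1) γ (Set.Icc 0 1) t)| := by
  set K : Set (ℝ × EuclideanSpace ℝ (Fin n)) :=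
    Set.Icc (0 : ℝ) 1 ×ˢ Metric.sphere 0 1 with hK
  have hKc : IsCompact K := isCompact_Icc.prod (isCompact_sphere _ _)
  set f : ℝ × EuclideanSpace ℝ (Fin n) → ℝ := fun q =>
    ∑ j : Fin n, |inner ℝ q.2 (iteratedDerivWithin ((j : ℕ) + 1) γ (Set.Icc 0 1) q.1)| with hf
  have hcont : ContinuousOn f K := by
    refine continuousOn_finsetSum _ fun j _ => ContinuousOn.abs ?_
    refine ContinuousOn.inner (𝕜 := ℝ) continuousOn_snd ?_
    refine (hγ.continuousOn_iteratedDerivWithin (m := (j : ℕ) + 1) ?_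
      (uniqueDiffOn_Icc zero_lt_one)).comp continuousOn_fst fun q hq => hq.1
    exact_mod_cast j.2
  have hpos : ∀ q ∈ K, 0 < f q := by
    rintro ⟨t, v⟩ ⟨ht, hv⟩
    refine lt_of_le_of_ne (sum_nonneg fun j _ => abs_nonneg _) fun h0 => ?_
    have h0' := (sum_eq_zero_iff_of_nonneg fun j _ => abs_nonneg _).1 h0.symm
    have hv0 : (fun i => v i) = 0 := by
      refine Matrix.eq_zero_of_vecMul_eq_zero (hnd t ht) ?_
      ext j
      have := abs_eq_zero.1 (h0' j (mem_univ j))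
      rw [PiLp.inner_apply] at this
      simpa [Matrix.vecMul, dotProduct, mul_comm] using this
    have : v = 0 := by
      ext i
      exact congrFun hv0 i
    simp [this] at hv
  rcases K.eq_empty_or_nonempty with hKe | hKne
  · refine ⟨1, one_pos, fun t ht v hv => ?_⟩
    have : (t, v) ∈ K := ⟨ht, by simpa using hv⟩
    simp [hKe] at this
  · obtain ⟨q, hq, hmin⟩ := hKc.exists_isMinOn hKne hcont
    exact ⟨f q, hpos q hq, fun t ht v hv => hmin (a := (t, v)) ⟨ht, by simpa using hv⟩⟩

lemma exists_uniform_modulus {n : ℕ} {γ : ℝ → EuclideanSpace ℝ (Fin n)}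
    (hγ : ContDiffOn ℝ n γ (Set.Icc 0 1)) {ω : ℝ} (hω : 0 < ω) :
    ∃ δ > 0, ∀ j ≤ n, ∀ x ∈ Set.Icc (0 : ℝ) 1, ∀ y ∈ Set.Icc (0 : ℝ) 1, |x - y| ≤ δ →
      ‖iteratedDerivWithin j γ (Set.Icc 0 1) x - iteratedDerivWithin j γ (Set.Icc 0 1) y‖ ≤ ω := by
  have key : ∀ j : Fin (n + 1), ∃ δ > 0, ∀ x ∈ Set.Icc (0 : ℝ) 1, ∀ y ∈ Set.Icc (0 : ℝ) 1,
      |x - y| < δ → ‖iteratedDerivWithin j γ (Set.Icc 0 1) x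
        - iteratedDerivWithin j γ (Set.Icc 0 1) y‖ < ω := by
    intro j
    have hc := hγ.continuousOn_iteratedDerivWithin (m := (j : ℕ))
      (by exact_mod_cast Nat.le_of_lt_succ j.2) (uniqueDiffOn_Icc zero_lt_one)
    have hu := isCompact_Icc.uniformContinuousOn_of_continuous hc
    obtain ⟨δ, hδ, h⟩ := Metric.uniformContinuousOn_iff.1 hu ω hω
    refine ⟨δ, hδ, fun x hx y hy hxy => ?_⟩
    rw [← dist_eq_norm]
    exact h x hx y hy (by rwa [Real.dist_eq])
  choose d hd hdh using key
  obtain ⟨j₀, -, hj₀⟩ := exists_min_image univ d univ_nonempty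
  refine ⟨d j₀ / 2, half_pos (hd j₀), fun j hj x hx y hy hxy => ?_⟩
  refine (hdh ⟨j, Nat.lt_succ_of_le hj⟩ x hx y hy ?_).le
  have := hj₀ ⟨j, Nat.lt_succ_of_le hj⟩ (mem_univ _)
  linarith [half_lt_self (hd j₀)]

lemma exists_norm_eq_one_inner_eq_zero {n : ℕ} (W : Finset (EuclideanSpace ℝ (Fin n)))
    (hW : #W < n) : ∃ v : EuclideanSpace ℝ (Fin n), ‖v‖ = 1 ∧ ∀ w ∈ W, inner ℝ v w = 0 := by
  set S := Submodule.span ℝ (W : Set (EuclideanSpace ℝ (Fin n))) with hS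
  have hST : S ≠ ⊤ := by
    intro h
    have h1 : Module.finrank ℝ S ≤ #W := finrank_span_finset_le_card W
    rw [h, finrank_top, finrank_euclideanSpace_fin] at h1
    omega
  have hSo : Sᗮ ≠ ⊥ := fun h => hST (Submodule.orthogonal_eq_bot_iff.1 h)
  obtain ⟨v, hv, hv0⟩ := Submodule.exists_mem_ne_zero_of_ne_bot hSo
  refine ⟨(‖v‖⁻¹ : ℝ) • v, ?_, fun w hw => ?_⟩
  · rw [norm_smul, norm_inv, norm_norm, inv_mul_cancel₀ (norm_ne_zero_iff.2 hv0)]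
  · rw [inner_smul_left, Submodule.inner_left_of_mem_orthogonal (Submodule.subset_span hw) hv,
      mul_zero]

lemma hasDerivWithinAt_inner_iteratedDerivWithin {n : ℕ} {γ : ℝ → EuclideanSpace ℝ (Fin n)}
    (hγ : ContDiffOn ℝ n γ (Set.Icc 0 1)) (v : EuclideanSpace ℝ (Fin n)) {j : ℕ} (hj : j < n)
    {a b : ℝ} (ha : 0 ≤ a) (hb : b ≤ 1) {x : ℝ} (hx : x ∈ Set.Icc a b) :
    HasDerivWithinAt (fun x => inner ℝ v (iteratedDerivWithin j γ (Set.Icc 0 1) x))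
      (inner ℝ v (iteratedDerivWithin (j + 1) γ (Set.Icc 0 1) x)) (Set.Icc a b) x := by
  have hsub : Set.Icc a b ⊆ Set.Icc 0 1 := Set.Icc_subset_Icc ha hb
  have h := (hγ.differentiableOn_iteratedDerivWithin (m := j) (by exact_mod_cast hj)
    (uniqueDiffOn_Icc zero_lt_one) x (hsub hx)).hasDerivWithinAt
  rw [← iteratedDerivWithin_succ] at h
  exact ((innerSL ℝ v).hasFDerivAt.comp_hasDerivWithinAt x h).mono hsub

/-- On short intervals the components of a non-degenerate curve form a Chebyshev-type system:
any set `Z` of fewer than `n` points is the zero set of a combination of the components of `γ'`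
whose derivative of order `#Z` is bounded below. -/
lemma NonDegenerate.exists_direction {n : ℕ} {γ : ℝ → EuclideanSpace ℝ (Fin n)}
    (hγ : ContDiffOn ℝ n γ (Set.Icc 0 1)) (hnd : NonDegenerate n γ) :
    ∃ δ > 0, ∃ c > 0, ∀ a b : ℝ, 0 ≤ a → a ≤ b → b ≤ 1 → b - a ≤ δ →
      ∀ Z : Finset ℝ, #Z < n → (∀ z ∈ Z, z ∈ Set.Icc a b) →
      ∃ v : EuclideanSpace ℝ (Fin n), ‖v‖ = 1 ∧
        (∀ z ∈ Z, inner ℝ v (iteratedDerivWithin 1 γ (Set.Icc 0 1) z) = 0) ∧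
        ∀ x ∈ Set.Icc a b, c ≤ inner ℝ v (iteratedDerivWithin (#Z + 1) γ (Set.Icc 0 1) x) := by
  obtain ⟨c, hc, hcle⟩ := hnd.exists_pos_le_sum hγ
  set ω : ℝ := c / (4 * (n + 1)) with hω
  have hω0 : 0 < ω := by positivity
  have hωn : (n + 1) * ω = c / 4 := by
    rw [hω]
    field_simp
  have hωc : ω ≤ c / 4 := by nlinarith [(Nat.cast_nonneg n : (0 : ℝ) ≤ n)]
  obtain ⟨δ, hδ, hmod⟩ := exists_uniform_modulus hγ hω0
  refine ⟨δ, hδ, c / 2, half_pos hc, fun a b ha hab hb hba Z hZ hmem => ?_⟩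
  set G : ℕ → ℝ → EuclideanSpace ℝ (Fin n) :=
    fun j => iteratedDerivWithin j γ (Set.Icc 0 1) with hG
  have hsub : Set.Icc a b ⊆ Set.Icc 0 1 := Set.Icc_subset_Icc ha hb
  have haa : a ∈ Set.Icc a b := ⟨le_rfl, hab⟩
  set W : Finset (EuclideanSpace ℝ (Fin n)) :=
    Z.image (G 1) ∪ (Ioo #Z n).image (fun j => G (j + 1) a) with hW
  have hWcard : #W < n := by
    refine (card_union_le _ _).trans_lt ?_
    have h1 := card_image_le (s := Z) (f := G 1)
    have h2 := card_image_le (s := Ioo #Z n) (f := fun j => G (j + 1) a)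
    rw [Nat.card_Ioo] at h2
    omega
  obtain ⟨v, hv, hvW⟩ := exists_norm_eq_one_inner_eq_zero W hWcard
  have hvZ : ∀ z ∈ Z, inner ℝ v (G 1 z) = 0 := fun z hz =>
    hvW _ (mem_union_left _ (mem_image_of_mem _ hz))
  have hosc : ∀ j ≤ n, ∀ x ∈ Set.Icc a b, ∀ y ∈ Set.Icc a b,
      |inner ℝ v (G j x) - inner ℝ v (G j y)| ≤ ω := by
    intro j hj x hx y hy
    rw [← inner_sub_right]
    refine (abs_real_inner_le_norm _ _).trans ?_
    rw [hv, one_mul]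
    refine hmod j hj x (hsub hx) y (hsub hy) (abs_le.2 ⟨?_, ?_⟩) <;>
      linarith [hx.1, hx.2, hy.1, hy.2]
  have hsmall : ∀ j < n, j ≠ #Z → ∀ x ∈ Set.Icc a b, |inner ℝ v (G (j + 1) x)| ≤ ω := by
    intro j hj hne x hx
    obtain ⟨y, hy, hy0⟩ : ∃ y ∈ Set.Icc a b, inner ℝ v (G (j + 1) y) = 0 := by
      rcases lt_or_gt_of_ne hne with hlt | hgt
      · refine exists_eq_zero_of_card_zeros j (fun i x => inner ℝ v (G (i + 1) x)) ?_ Z hlt hmem hvZ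
        intro i hi x hx
        exact hasDerivWithinAt_inner_iteratedDerivWithin hγ v (by omega) ha hb hx
      · exact ⟨a, haa, hvW _ (mem_union_right _ (mem_image.2 ⟨j, mem_Ioo.2 ⟨hgt, hj⟩, rfl⟩))⟩
    have := hosc (j + 1) hj x hx y hy
    rwa [hy0, sub_zero] at this
  have hbig : 3 * c / 4 ≤ |inner ℝ v (G (#Z + 1) a)| := by
    have h1 := hcle a (hsub haa) v hv
    rw [← add_sum_erase univ _ (mem_univ (⟨#Z, hZ⟩ : Fin n))] at h1
    have h2 : ∑ j ∈ univ.erase (⟨#Z, hZ⟩ : Fin n), |inner ℝ v (G ((j : ℕ) + 1) a)| ≤ n * ω := by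
      refine (sum_le_card_nsmul _ _ ω fun j hj => ?_).trans ?_
      · exact hsmall j j.2 (fun h => (mem_erase.1 hj).1 (Fin.ext h)) a haa
      · rw [nsmul_eq_mul]
        gcongr
        exact (card_le_univ _).trans (by simp)
    simp only [hG] at h2 ⊢
    linarith
  rcases le_total 0 (inner ℝ v (G (#Z + 1) a)) with hs | hs
  · refine ⟨v, hv, hvZ, fun x hx => ?_⟩
    rw [abs_of_nonneg hs] at hbig
    have := (abs_le.1 (hosc (#Z + 1) hZ x hx a haa)).1
    simp only [hG] at this hbig
    linarith
  · refine ⟨-v, by rwa [norm_neg], fun z hz => by rw [inner_neg_left, hvZ z hz, neg_zero],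
      fun x hx => ?_⟩
    rw [abs_of_nonpos hs] at hbig
    rw [inner_neg_left]
    have := (abs_le.1 (hosc (#Z + 1) hZ x hx a haa)).2
    simp only [hG] at this hbig
    linarith

/-- The case of sorted points, with the dissection replaced by the separation of one pair. -/
lemma NonDegenerate.exists_le_norm_sum {n : ℕ} {γ : ℝ → EuclideanSpace ℝ (Fin n)}
    (hγ : ContDiffOn ℝ n γ (Set.Icc 0 1)) (hnd : NonDegenerate n γ) :
    ∃ δ > 0, ∃ c > 0, ∀ a b : ℝ, 0 ≤ a → a ≤ b → b ≤ 1 → b - a ≤ δ →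
      ∀ t s : Fin n → ℝ, Monotone t → Monotone s →
      (∀ i, t i ∈ Set.Icc a b) → (∀ i, s i ∈ Set.Icc a b) →
      ∀ h : ℝ, 0 < h → ∀ i₀, n * h ≤ |t i₀ - s i₀| →
      ∃ k, 1 ≤ k ∧ k ≤ n ∧ c * (h / 2) ^ k ≤ ‖∑ i, (γ (t i) - γ (s i))‖ := by
  obtain ⟨δ, hδ, c, hc, hdir⟩ := hnd.exists_direction hγ
  refine ⟨δ, hδ, c, hc, fun a b ha hab hb hba t s ht hs htm hsm h hh i₀ hi₀ => ?_⟩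
  have hn : (0 : ℝ) < n := by exact_mod_cast i₀.pos
  have hne : t i₀ ≠ s i₀ := by
    intro heq
    rw [heq, sub_self, abs_zero] at hi₀
    exact absurd hi₀ (not_le.2 (by positivity))
  rcases exists_sign_pattern ht hs univ with hall | ⟨Z, e, l, -, hZ, he, -, -, hZm, hsign⟩
  · exact absurd (hall i₀ (mem_univ _)) hne
  rw [card_univ, Fintype.card_fin] at hZ
  have hZab : ∀ z ∈ Z, z ∈ Set.Icc a b := by
    intro z hz
    obtain ⟨i, -, rfl⟩ := hZm z hz
    exact ⟨le_min (htm i).1 (hsm i).1, (min_le_left _ _).trans (htm i).2⟩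
  obtain ⟨v, hv, hvZ, hvc⟩ := hdir a b ha hab hb hba Z hZ hZab
  set D : ℕ → ℝ → ℝ := fun j x => inner ℝ v (iteratedDerivWithin j γ (Set.Icc 0 1) x) with hD
  have hD0 : ∀ x, D 0 x = inner ℝ v (γ x) := fun x => by simp [hD]
  have hderiv : ∀ j < n, ∀ {a' b' x : ℝ}, a ≤ a' → b' ≤ b → x ∈ Set.Icc a' b' →
      HasDerivWithinAt (D j) (D (j + 1) x) (Set.Icc a' b') x :=
    fun j hj _ _ _ ha' hb' hx =>
      hasDerivWithinAt_inner_iteratedDerivWithin hγ v hj (ha.trans ha') (hb'.trans hb) hx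
  have hprod : ∀ u ∈ Set.Icc a b, 0 ≤ D 1 u * ∏ z ∈ Z, (u - z) := fun u hu =>
    mul_prod_sub_nonneg (fun j => D (j + 1)) Z
      (fun j hj x hx => hderiv (j + 1) (by omega) le_rfl le_rfl hx) hZab hvZ
      (fun x hx => hc.le.trans (hvc x hx)) hu
  have hD1 : ∀ i, ∀ u, min (t i) (s i) ≤ u → u ≤ max (t i) (s i) →
      0 ≤ e * (t i - s i) * D 1 u := by
    intro i u hu1 hu2
    have hu : u ∈ Set.Icc a b :=
      ⟨(le_min (htm i).1 (hsm i).1).trans hu1, hu2.trans (max_le (htm i).2 (hsm i).2)⟩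
    by_cases huZ : u ∈ Z
    · have : D 1 u = 0 := hvZ u huZ
      simp [this]
    have hP : ∏ z ∈ Z, (u - z) ≠ 0 :=
      prod_ne_zero_iff.2 fun z hz h0 => huZ (by rwa [sub_eq_zero.1 h0])
    have h1 := mul_nonneg (hsign i (mem_univ _) u hu1 hu2) (hprod u hu)
    have h2 : 0 < (∏ z ∈ Z, (u - z)) ^ 2 := by positivity
    refine nonneg_of_mul_nonneg_left (b := (∏ z ∈ Z, (u - z)) ^ 2) ?_ h2
    calc (0 : ℝ) ≤ _ := h1
      _ = _ := by ring
  have hmono : ∀ i, ∃ f : ℝ, (f = 1 ∨ f = -1) ∧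
      MonotoneOn (fun x => f * D 0 x) (Set.Icc (min (t i) (s i)) (max (t i) (s i))) ∧
      e * (D 0 (t i) - D 0 (s i)) =
        f * D 0 (max (t i) (s i)) - f * D 0 (min (t i) (s i)) := by
    intro i
    have hder : ∀ x ∈ Set.Icc (min (t i) (s i)) (max (t i) (s i)), HasDerivWithinAt (D 0) (D 1 x)
        (Set.Icc (min (t i) (s i)) (max (t i) (s i))) x := fun x hx =>
      hderiv 0 (by omega) (le_min (htm i).1 (hsm i).1) (max_le (htm i).2 (hsm i).2) hx
    have main : ∀ f : ℝ, (∀ u, min (t i) (s i) < u → u < max (t i) (s i) → 0 ≤ f * D 1 u) →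
        MonotoneOn (fun x => f * D 0 x) (Set.Icc (min (t i) (s i)) (max (t i) (s i))) := by
      intro f hf
      refine monotoneOn_of_hasDerivWithinAt_nonneg (f' := fun x => f * D 1 x) (convex_Icc _ _)
        (fun x hx => ((hder x hx).const_mul f).continuousWithinAt) ?_ ?_
      · exact fun x hx => ((hder x (interior_subset hx)).const_mul f).mono interior_subset
      · intro x hx
        rw [interior_Icc] at hx
        exact hf x hx.1 hx.2
    rcases le_total (s i) (t i) with hst | hst
    · refine ⟨e, he, main e fun u hu1 hu2 => ?_, ?_⟩
      · have h1 := hD1 i u hu1.le hu2.le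
        rw [min_eq_right hst] at hu1
        rw [max_eq_left hst] at hu2
        refine nonneg_of_mul_nonneg_left (b := t i - s i) ?_ (by linarith)
        linarith
      · rw [min_eq_right hst, max_eq_left hst]
        ring
    · refine ⟨-e, ?_, main (-e) fun u hu1 hu2 => ?_, ?_⟩
      · rcases he with rfl | rfl <;> simp
      · have h1 := hD1 i u hu1.le hu2.le
        rw [min_eq_left hst] at hu1
        rw [max_eq_right hst] at hu2
        refine nonneg_of_mul_nonneg_left (b := s i - t i) ?_ (by linarith)
        linarith
      · rw [min_eq_left hst, max_eq_right hst]
        ring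
  have hnonneg : ∀ i, 0 ≤ e * (D 0 (t i) - D 0 (s i)) := by
    intro i
    obtain ⟨f, -, hf, heq⟩ := hmono i
    rw [heq, sub_nonneg]
    exact hf ⟨le_rfl, min_le_max⟩ ⟨min_le_max, le_rfl⟩ min_le_max
  have hlower : c * h ^ (#Z + 1) ≤ 2 ^ (#Z + 1) * (e * (D 0 (t i₀) - D 0 (s i₀))) := by
    obtain ⟨f, hf1, hf, heq⟩ := hmono i₀
    set p := min (t i₀) (s i₀)
    set q := max (t i₀) (s i₀)
    have hap : a ≤ p := le_min (htm i₀).1 (hsm i₀).1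
    have hqb : q ≤ b := max_le (htm i₀).2 (hsm i₀).2
    have hpq : p ≤ q := min_le_max
    have hlen : p + (#Z + 1 : ℕ) * h ≤ q := by
      have h1 : q - p = |t i₀ - s i₀| := max_sub_min_eq_abs' _ _
      have h2 : ((#Z + 1 : ℕ) : ℝ) * h ≤ n * h := by
        gcongr
        exact hZ
      linarith
    have habs : ∀ x, |f * x| = |x| := fun x => by
      rcases hf1 with rfl | rfl <;> simp
    refine mul_pow_le_of_abs_le hh (#Z + 1) hlen
      (fun j x => if j = 0 then D 0 x - D 0 p else D j x) ?_ ?_ ?_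
    · intro j hj x hx
      have hj' := hderiv j (by omega) hap hqb hx
      rcases Nat.eq_zero_or_pos j with rfl | hj0
      · simpa using hj'.sub_const (D 0 p)
      · simpa [hj0.ne'] using hj'
    · intro x hx
      simpa using hvc x ⟨hap.trans hx.1, hx.2.trans hqb⟩
    · intro x hx
      have h1 : f * D 0 p ≤ f * D 0 x := hf ⟨le_rfl, hpq⟩ hx hx.1
      have h2 : f * D 0 x ≤ f * D 0 q := hf hx ⟨hpq, le_rfl⟩ hx.2
      simp only [if_true]
      rw [heq, ← habs, mul_sub, abs_of_nonneg (by linarith)]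
      linarith
  refine ⟨#Z + 1, by omega, hZ, ?_⟩
  calc c * (h / 2) ^ (#Z + 1) = c * h ^ (#Z + 1) / 2 ^ (#Z + 1) := by
        rw [div_pow, mul_div_assoc]
    _ ≤ e * (D 0 (t i₀) - D 0 (s i₀)) := by
        rw [div_le_iff₀ (by positivity)]
        linarith
    _ ≤ ∑ i, e * (D 0 (t i) - D 0 (s i)) :=
        single_le_sum (f := fun i => e * (D 0 (t i) - D 0 (s i))) (fun i _ => hnonneg i)
          (mem_univ i₀)
    _ = e * inner ℝ v (∑ i, (γ (t i) - γ (s i))) := by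
        rw [← mul_sum, inner_sum]
        simp only [hD0, inner_sub_right]
    _ ≤ |inner ℝ v (∑ i, (γ (t i) - γ (s i)))| := by
        rcases he with rfl | rfl
        · simpa using le_abs_self _
        · simpa using neg_le_abs _
    _ ≤ ‖v‖ * ‖∑ i, (γ (t i) - γ (s i))‖ := abs_real_inner_le_norm _ _
    _ = ‖∑ i, (γ (t i) - γ (s i))‖ := by rw [hv, one_mul]

/-- Near-solutions of `γ(t_1)+⋯+γ(t_n) = γ(s_1)+⋯+γ(s_n)` with points chosen
from well-separated intervals of a dissection are essentially diagonal
(Proposition 1.3).  Intervals of the dissection are indexed by `ℓ < R`, the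
interval of index `ℓ` being `[ℓ/R, (ℓ+1)/R]`. -/
theorem essentially_diagonal (n : ℕ) (γ : ℝ → EuclideanSpace ℝ (Fin n))
    (hγ : ContDiffOn ℝ n γ (Set.Icc 0 1)) (hnd : NonDegenerate n γ) :
    ∃ δ₀ c₀ : ℝ, 0 < δ₀ ∧ δ₀ ≤ 1 ∧ 10 ≤ c₀ ∧
      ∀ R : ℕ, 1 ≤ R → ∀ 𝓘 : Finset ℕ, (∀ ℓ ∈ 𝓘, ℓ < R) →
      (∀ ℓ ∈ 𝓘, ∀ ℓ' ∈ 𝓘, ℓ ≠ ℓ' →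
        ∀ x ∈ Set.Icc ((ℓ : ℝ) / R) ((ℓ + 1 : ℝ) / R),
        ∀ y ∈ Set.Icc ((ℓ' : ℝ) / R) ((ℓ' + 1 : ℝ) / R), c₀ / R ≤ |x - y|) →
      Metric.diam (⋃ ℓ ∈ 𝓘, Set.Icc ((ℓ : ℝ) / R) ((ℓ + 1 : ℝ) / R)) ≤ δ₀ →
      ∀ A B : Fin n → ℕ, (∀ i, A i ∈ 𝓘) → (∀ i, B i ∈ 𝓘) →
      (¬ ∃ σ : Equiv.Perm (Fin n), ∀ i, A (σ i) = B i) →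
      ∀ t s : Fin n → ℝ,
      (∀ i, t i ∈ Set.Icc ((A i : ℝ) / R) ((A i + 1 : ℝ) / R)) →
      (∀ i, s i ∈ Set.Icc ((B i : ℝ) / R) ((B i + 1 : ℝ) / R)) →
      ((R : ℝ) ^ n)⁻¹ ≤ ‖∑ i, (γ (t i) - γ (s i))‖ := by
  obtain ⟨δ, hδ, c, hc, hmain⟩ := hnd.exists_le_norm_sum hγ
  refine ⟨min δ 1, 10 + 2 * n * (1 + 1 / c), lt_min hδ one_pos, min_le_right _ _, ?_, ?_⟩
  · have : 0 ≤ 2 * (n : ℝ) * (1 + 1 / c) := by positivity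
    linarith
  intro R hR 𝓘 h𝓘 hsep hdiam A B hA hB hAB t s ht hs
  have hR0 : (0 : ℝ) < R := by exact_mod_cast hR
  set U : Set ℝ := ⋃ ℓ ∈ 𝓘, Set.Icc ((ℓ : ℝ) / R) ((ℓ + 1 : ℝ) / R) with hU
  have hU01 : U ⊆ Set.Icc 0 1 := by
    refine Set.iUnion₂_subset fun ℓ hℓ => Set.Icc_subset_Icc (by positivity) ?_
    rw [div_le_one hR0]
    exact_mod_cast h𝓘 ℓ hℓ
  have htU : ∀ i, t i ∈ U := fun i => Set.mem_biUnion (hA i) (ht i)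
  have hsU : ∀ i, s i ∈ U := fun i => Set.mem_biUnion (hB i) (hs i)
  have hUb : Bornology.IsBounded U := Metric.isBounded_Icc 0 1 |>.subset hU01
  set σ := Tuple.sort t
  set τ := Tuple.sort s
  obtain ⟨i₀, hi₀⟩ : ∃ i, A (σ i) ≠ B (τ i) := by
    by_contra! hcon
    refine hAB ⟨τ.symm.trans σ, fun i => ?_⟩
    simpa using hcon (τ.symm i)
  have hn : (0 : ℝ) < n := by exact_mod_cast i₀.pos
  have hUne : U.Nonempty := ⟨_, htU i₀⟩
  have hUIcc : U ⊆ Set.Icc (sInf U) (sSup U) := fun x hx =>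
    ⟨csInf_le hUb.bddBelow hx, le_csSup hUb.bddAbove hx⟩
  obtain ⟨k, hk1, hkn, hk⟩ := hmain (sInf U) (sSup U) (le_csInf hUne fun x hx => (hU01 hx).1)
    ((hUIcc (htU i₀)).1.trans (hUIcc (htU i₀)).2) (csSup_le hUne fun x hx => (hU01 hx).2)
    (by rw [← Real.diam_eq hUb]; exact hdiam.trans (min_le_left _ _))
    (t ∘ σ) (s ∘ τ) (Tuple.monotone_sort t) (Tuple.monotone_sort s)
    (fun i => hUIcc (htU _)) (fun i => hUIcc (hsU _))
    (2 * (1 + 1 / c) / R) (by positivity) i₀ (by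
      refine le_trans ?_ (hsep _ (hA _) _ (hB _) hi₀ _ (ht _) _ (hs _))
      rw [← mul_div_assoc]
      gcongr
      linarith)
  have hsum : ∑ i, (γ ((t ∘ σ) i) - γ ((s ∘ τ) i)) = ∑ i, (γ (t i) - γ (s i)) := by
    rw [sum_sub_distrib, sum_sub_distrib]
    congr 1
    exacts [Equiv.sum_comp σ fun i => γ (t i), Equiv.sum_comp τ fun i => γ (s i)]
  rw [hsum] at hk
  refine le_trans ?_ hk
  have hc1 : 1 ≤ c * (1 + 1 / c) ^ k := by
    have h1 : 1 + 1 / c ≤ (1 + 1 / c) ^ k :=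
      le_self_pow₀ (by linarith [one_div_pos.2 hc]) (by omega)
    calc (1 : ℝ) ≤ c * (1 + 1 / c) := by
          rw [mul_add, mul_one_div_cancel hc.ne']
          linarith
      _ ≤ _ := by gcongr
  calc ((R : ℝ) ^ n)⁻¹ ≤ ((R : ℝ) ^ k)⁻¹ := by
        gcongr
        exact_mod_cast hR
    _ ≤ c * (1 + 1 / c) ^ k * ((R : ℝ) ^ k)⁻¹ := le_mul_of_one_le_left (by positivity) hc1
    _ = c * (2 * (1 + 1 / c) / R / 2) ^ k := by
        rw [show 2 * (1 + 1 / c) / (R : ℝ) / 2 = (1 + 1 / c) / R by ring, div_pow]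
        ring
end
end

section
/- Let n ≥ 1 be an integer, R ≥ 1 an integer, and c_0 ≥ 10 a real number. Let 𝓘 be a set of intervals from the dissection of [0,1] into intervals of length R^{-1} such that dist(I,I') ≥ c_0·R^{-1} for all distinct I, I' ∈ 𝓘. Let I_1,...,I_n, I_1',...,I_n' ∈ 𝓘 be such that (I_1,...,I_n) is not a permutation of (I_1',...,I_n'), let t_i ∈ I_i and s_i ∈ I_i' for 1 ≤ i ≤ n, and define Ξ(t) = ∑_{i=1}^n χ_{[s_i, t_i)}(t). Then there exist n essentially disjoint closed intervals J_1, ..., J_n with c(J_1) < c(J_2) < ... < c(J_n) such that: the support of Ξ is contained in ⋃_{j=1}^n J_j; for each j, on the interior of J_j the function Ξ is either everywhere positive or everywhere negative, with 1 ≤ |Ξ(t)| ≤ n there; and there exists an index j_0 with |J_{j_0}| ≥ (c_0/n)·R^{-1}. -/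
open Finset

noncomputable section

/-- The signed indicator `χ_{[x,y)}`: equal to `+1` if `x ≤ t < y`, `-1` if
`y ≤ t < x`, and `0` otherwise. -/
def chiInt (x y t : ℝ) : ℝ :=
  if x ≤ t ∧ t < y then 1 else if y ≤ t ∧ t < x then -1 else 0

theorem chiInt_eq_sub (x y u : ℝ) :
    chiInt x y u = (((if x ≤ u then 1 else 0) - (if y ≤ u then 1 else 0) : ℤ) : ℝ) := by
  unfold chiInt
  split_ifs <;> grind

/-- The values of `s` and `t` listed in increasing order as `r 0, …, r (2n - 1)`, where `ε` is
`1` at the values of `s` and `-1` at those of `t`; the list is continued by a nondecreasing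
sequence in which every value occurs twice. -/
theorem exists_sorted_signed (n : ℕ) (s t : Fin n → ℝ) :
    ∃ (r : ℕ → ℝ) (ε : ℕ → ℤ), Monotone r ∧
      (∀ k < 2 * n, ε k = 1 ∨ ε k = -1) ∧
      (∀ k < 2 * n, (∃ i, r k = s i) ∨ ∃ i, r k = t i) ∧
      (∀ j, n ≤ j → r (2 * j) = r (2 * j + 1)) ∧
      (∀ i j, n ≤ i → i < j → r (2 * i) < r (2 * j)) ∧
      (∀ F : ℝ → ℤ, ∑ k ∈ range (2 * n), ε k * F (r k) = ∑ i, (F (s i) - F (t i))) := by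
  obtain ⟨m, hm⟩ : ∃ m, m = 2 * n := ⟨_, rfl⟩
  have e : Fin m ≃ Fin n ⊕ Fin n := (finCongr (by omega)).trans finSumFinEquiv.symm
  let g : Fin m → ℝ := fun k => Sum.elim s t (e k)
  let d : Fin m → ℤ := fun k => Sum.elim (fun _ => 1) (fun _ => -1) (e k)
  let σ := Tuple.sort g
  have hσ : Monotone (g ∘ σ) := Tuple.monotone_sort g
  obtain ⟨M, hM⟩ := (Set.finite_range g).bddAbove
  have hM' : ∀ k, g k ≤ M := fun k => hM ⟨k, rfl⟩
  refine ⟨fun k => if h : k < m then g (σ ⟨k, h⟩) else M + (k / 2 : ℕ),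
    fun k => if h : k < m then d (σ ⟨k, h⟩) else 0, ?_, ?_, ?_, ?_, ?_, ?_⟩
  · intro a b hab
    by_cases hb : b < m
    · have ha : a < m := by omega
      simp only [ha, hb, dite_true]
      exact hσ (show (⟨a, ha⟩ : Fin m) ≤ ⟨b, hb⟩ from hab)
    · by_cases ha : a < m
      · simp only [ha, hb, dite_true, dite_false]
        have := hM' (σ ⟨a, ha⟩)
        have h0 : (0 : ℝ) ≤ (b / 2 : ℕ) := Nat.cast_nonneg _
        linarith
      · simp only [ha, hb, dite_false]
        gcongr
  · intro k hk
    have hk' : k < m := by omega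
    simp only [hk', dite_true, d]
    rcases e (σ ⟨k, hk'⟩) with i | i <;> simp
  · intro k hk
    have hk' : k < m := by omega
    simp only [hk', dite_true, g]
    rcases e (σ ⟨k, hk'⟩) with i | i
    · exact Or.inl ⟨i, rfl⟩
    · exact Or.inr ⟨i, rfl⟩
  · intro j hj
    have h1 : ¬ 2 * j < m := by omega
    have h2 : ¬ 2 * j + 1 < m := by omega
    have h3 : (2 * j + 1) / 2 = 2 * j / 2 := by omega
    simp only [h1, h2, dite_false, h3]
  · intro i j hi hij
    have h1 : ¬ 2 * i < m := by omega
    have h2 : ¬ 2 * j < m := by omega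
    simp only [h1, h2, dite_false]
    have : 2 * i / 2 < 2 * j / 2 := by omega
    gcongr
  · intro F
    rw [← hm, Finset.sum_range]
    simp only [Fin.is_lt, dite_true, Fin.eta]
    rw [Equiv.sum_comp σ (fun k => d k * F (g k)),
      Equiv.sum_comp e (fun k => Sum.elim (fun _ => (1 : ℤ)) (fun _ => -1) k *
        F (Sum.elim s t k))]
    simp [Fintype.sum_sum_type, Finset.sum_add_distrib, sub_eq_add_neg]

theorem sum_range_signs_emod_two {ε : ℕ → ℤ} {m : ℕ} (hε : ∀ k < m, ε k = 1 ∨ ε k = -1) :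
    ∀ k ≤ m, (∑ i ∈ range k, ε i) % 2 = (k : ℤ) % 2 := by
  intro k
  induction k with
  | zero => simp
  | succ k ih =>
    intro hk
    have := ih (by omega)
    rw [Finset.sum_range_succ]
    rcases hε k (by omega) with h | h <;> push_cast <;> omega

/-- A partial sum of weights over the points `≤ u` of an increasing sequence is an initial sum. -/
theorem exists_initial_sum (r : ℕ → ℝ) (hr : Monotone r) (ε : ℕ → ℤ) (m : ℕ) (u : ℝ) :
    ∃ k ≤ m, (∀ i < k, r i ≤ u) ∧ (∀ i, k ≤ i → i < m → u < r i) ∧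
      ∑ i ∈ range m, ε i * (if r i ≤ u then 1 else 0) = ∑ i ∈ range k, ε i := by
  induction m with
  | zero => exact ⟨0, le_rfl, by simp, by simp, by simp⟩
  | succ m ih =>
    obtain ⟨k, hk, h1, h2, h3⟩ := ih
    by_cases h : r m ≤ u
    · refine ⟨m + 1, le_rfl, fun i hi => (hr (by omega)).trans h, by intros; omega, ?_⟩
      refine Finset.sum_congr rfl fun i hi => ?_
      rw [if_pos ((hr (by grind)).trans h), mul_one]
    · refine ⟨k, by omega, h1, fun i hi hi' => ?_, ?_⟩
      · rcases Nat.lt_succ_iff_lt_or_eq.mp hi' with h' | rfl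
        · exact h2 i hi h'
        · exact not_le.mp h
      · rw [Finset.sum_range_succ, h3, if_neg h]; simp

/-- If two finite families of naturals are not rearrangements of each other, the numbers of their
members below some common threshold differ, and the threshold is a member. -/
theorem exists_card_le_ne {n : ℕ} (A B : Fin n → ℕ)
    (hperm : ¬ ∃ σ : Equiv.Perm (Fin n), ∀ i, A (σ i) = B i) :
    ∃ L, ((∃ i, A i = L) ∨ ∃ i, B i = L) ∧
      (univ.filter fun i => A i ≤ L).card ≠ (univ.filter fun i => B i ≤ L).card := by
  classical
  have hex : ∃ L, (univ.filter fun i => A i = L).card ≠ (univ.filter fun i => B i = L).card := by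
    by_contra! h
    apply hperm
    have hfib : ∀ L, Nonempty ({i // B i = L} ≃ {i // A i = L}) := fun L =>
      Fintype.card_eq.mp (by rw [Fintype.card_subtype, Fintype.card_subtype, h L])
    exact ⟨Equiv.ofFiberEquiv fun L => (hfib L).some, Equiv.ofFiberEquiv_map _⟩
  have hsum : ∀ (C : Fin n → ℕ) L, (univ.filter fun i => C i ≤ L).card =
      ∑ l ∈ range L, (univ.filter fun i => C i = l).card + (univ.filter fun i => C i = L).card := by
    intro C L
    rw [← Finset.sum_range_succ, Finset.card_eq_sum_card_fiberwise (f := C) (t := range (L + 1))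
      (by intro i hi; simp at hi ⊢; omega)]
    refine Finset.sum_congr rfl fun l hl => ?_
    rw [Finset.filter_filter]
    congr 1
    ext i
    simp at hl ⊢
    omega
  refine ⟨Nat.find hex, ?_, ?_⟩
  · by_contra! h
    exact Nat.find_spec hex (by simp [h.1, h.2])
  · rw [hsum, hsum, Finset.sum_congr rfl fun l hl =>
      not_not.mp (Nat.find_min hex (Finset.mem_range.mp hl))]
    have := Nat.find_spec hex
    omega

/-- Discarding degenerate intervals from an ordered list and padding with further points. -/
theorem exists_strictMono_selection (n : ℕ) (α β : ℕ → ℝ) (hαβ : ∀ j, α j ≤ β j)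
    (hβα : ∀ i j, i < j → β i ≤ α j) (hpad : ∀ i j, n ≤ i → i < j → α i < α j) :
    ∃ e : Fin n → ℕ, (∀ i j, i < j → e i < e j) ∧
      StrictMono (fun j => (α (e j) + β (e j)) / 2) ∧
      ∀ i < n, α i < β i → ∃ j, e j = i := by
  classical
  obtain ⟨U, hSU, hUT, hU⟩ := Finset.exists_subsuperset_card_eq (n := n)
    (s := (range n).filter fun i => α i < β i)
    (t := ((range n).filter fun i => α i < β i) ∪ Finset.Ico n (2 * n))
    Finset.subset_union_left
    ((Finset.card_filter_le _ _).trans (by simp))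
    (le_trans (by simp; omega) (Finset.card_le_card Finset.subset_union_right))
  have hmono : ∀ i j, i < j → U.orderEmbOfFin hU i < U.orderEmbOfFin hU j := fun i j h =>
    (U.orderEmbOfFin hU).strictMono h
  refine ⟨U.orderEmbOfFin hU, hmono, ?_, ?_⟩
  · intro i j hij
    have h := hmono i j hij
    have hi := hUT (Finset.orderEmbOfFin_mem U hU i)
    beta_reduce
    generalize U.orderEmbOfFin hU i = a at *
    generalize U.orderEmbOfFin hU j = b at *
    have h1 := hβα a b h
    have h2 := hαβ a
    have h3 := hαβ b
    simp only [Finset.mem_union, Finset.mem_filter, Finset.mem_Ico] at hi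
    rcases hi with hi | hi
    · linarith [hi.2]
    · linarith [hpad a b hi.1 h]
  · intro i hi h
    have : i ∈ Set.range (U.orderEmbOfFin hU) := by
      rw [Finset.range_orderEmbOfFin]
      exact hSU (by simp [hi, h])
    exact this

/-- Proposition 5.1: decomposition of the support of
`Ξ(t) = ∑_i χ_{[s_i, t_i)}(t)` into `n` essentially disjoint closed intervals
on each of which `Ξ` has a fixed sign, of which one has length at least
`(c₀/n) R⁻¹`.  The intervals of the dissection of `[0,1]` are indexed by
`ℓ < R`, the interval of index `ℓ` being `[ℓ/R, (ℓ+1)/R]`. -/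
theorem support_decomposition (n R : ℕ) (hn : 1 ≤ n) (hR : 1 ≤ R)
    (c₀ : ℝ) (hc₀ : 10 ≤ c₀)
    (𝓘 : Finset ℕ) (h𝓘 : ∀ ℓ ∈ 𝓘, ℓ < R)
    (hsep : ∀ ℓ ∈ 𝓘, ∀ ℓ' ∈ 𝓘, ℓ ≠ ℓ' →
      ∀ x ∈ Set.Icc ((ℓ : ℝ) / R) ((ℓ + 1 : ℝ) / R),
      ∀ y ∈ Set.Icc ((ℓ' : ℝ) / R) ((ℓ' + 1 : ℝ) / R), c₀ / R ≤ |x - y|)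
    (A B : Fin n → ℕ) (hA : ∀ i, A i ∈ 𝓘) (hB : ∀ i, B i ∈ 𝓘)
    (hperm : ¬ ∃ σ : Equiv.Perm (Fin n), ∀ i, A (σ i) = B i)
    (t s : Fin n → ℝ)
    (ht : ∀ i, t i ∈ Set.Icc ((A i : ℝ) / R) ((A i + 1 : ℝ) / R))
    (hs : ∀ i, s i ∈ Set.Icc ((B i : ℝ) / R) ((B i + 1 : ℝ) / R)) :
    ∃ α β : Fin n → ℝ,
      (∀ j, α j ≤ β j) ∧
      (∀ i j, i ≠ j →
        Set.Icc (α i) (β i) ∩ Set.Icc (α j) (β j) ⊆ {α i, β i}) ∧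
      StrictMono (fun j => (α j + β j) / 2) ∧
      (∀ u : ℝ, (∑ i, chiInt (s i) (t i) u) ≠ 0 →
        u ∈ ⋃ j, Set.Icc (α j) (β j)) ∧
      (∀ j, (∀ u ∈ Set.Ioo (α j) (β j), 0 < ∑ i, chiInt (s i) (t i) u) ∨
            (∀ u ∈ Set.Ioo (α j) (β j), ∑ i, chiInt (s i) (t i) u < 0)) ∧
      (∀ j, ∀ u ∈ Set.Ioo (α j) (β j),
        1 ≤ |∑ i, chiInt (s i) (t i) u| ∧ |∑ i, chiInt (s i) (t i) u| ≤ n) ∧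
      (∃ j₀ : Fin n, (c₀ / n) / R ≤ β j₀ - α j₀) := by
  obtain ⟨r, ε, hr, hε, hrng, hdeg, hpad, hF⟩ := exists_sorted_signed n s t
  obtain ⟨W, hW⟩ : ∃ W : ℕ → ℤ, ∀ k, W k = ∑ i ∈ range k, ε i := ⟨_, fun _ => rfl⟩
  have hW0 : W 0 = 0 := by simp [hW]
  have hWn : W (2 * n) = 0 := by simpa [hW] using hF fun _ => 1
  have hWs : ∀ k, W (k + 1) = W k + ε k := fun k => by rw [hW, hW, Finset.sum_range_succ]
  have hodd : ∀ k ≤ 2 * n, W k % 2 = (k : ℤ) % 2 := fun k hk => by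
    rw [hW]; exact sum_range_signs_emod_two hε k hk
  have hΞ : ∀ u, ∃ k ≤ 2 * n, (∀ i < k, r i ≤ u) ∧ (∀ i, k ≤ i → i < 2 * n → u < r i) ∧
      ∑ i, chiInt (s i) (t i) u = (W k : ℝ) := by
    intro u
    obtain ⟨k, hk, h1, h2, h3⟩ := exists_initial_sum r hr ε (2 * n) u
    refine ⟨k, hk, h1, h2, ?_⟩
    rw [hW, ← h3, hF fun x => if x ≤ u then 1 else 0, Int.cast_sum]
    exact Finset.sum_congr rfl fun i _ => chiInt_eq_sub _ _ _
  have habs : ∀ u, |∑ i, chiInt (s i) (t i) u| ≤ n := by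
    intro u
    refine (Finset.abs_sum_le_sum_abs _ _).trans ?_
    refine (Finset.sum_le_card_nsmul _ _ 1 fun i _ => ?_).trans (by simp)
    unfold chiInt
    split_ifs <;> simp
  obtain ⟨α, hα⟩ : ∃ α : ℕ → ℝ, ∀ j, α j = r (2 * j) := ⟨_, fun _ => rfl⟩
  obtain ⟨β, hβ⟩ : ∃ β : ℕ → ℝ, ∀ j, β j =
      if j < n ∧ W (2 * j + 2) ≠ 0 then r (2 * j + 2) else r (2 * j + 1) := ⟨_, fun _ => rfl⟩
  have hβle : ∀ j, β j ≤ r (2 * j + 2) := fun j => by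
    rw [hβ]; split_ifs
    exacts [le_rfl, hr (by omega)]
  have hleβ : ∀ j, r (2 * j + 1) ≤ β j := fun j => by
    rw [hβ]; split_ifs
    exacts [hr (by omega), le_rfl]
  have hαβ : ∀ j, α j ≤ β j := fun j => by
    rw [hα]; exact (hr (by omega)).trans (hleβ j)
  have hβα : ∀ i j, i < j → β i ≤ α j := fun i j h => by
    rw [hα]; exact (hβle i).trans (hr (by omega))
  have hcover : ∀ k ≤ 2 * n, W k ≠ 0 →
      ∃ j < n, 2 * j + 1 ≤ k ∧ k < 2 * n ∧ α j ≤ r (k - 1) ∧ r k ≤ β j := by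
    intro k hk hk0
    have h0 : k ≠ 0 := by rintro rfl; exact hk0 hW0
    have h2n : k ≠ 2 * n := by rintro rfl; exact hk0 hWn
    refine ⟨(k - 1) / 2, by omega, by omega, by omega, ?_, ?_⟩
    · rw [hα]; exact hr (by omega)
    · rcases Nat.even_or_odd' k with ⟨j, rfl | rfl⟩
      · have h : 2 * ((2 * j - 1) / 2) + 2 = 2 * j := by omega
        rw [hβ, h, if_pos ⟨by omega, hk0⟩]
      · have h : 2 * ((2 * j + 1 - 1) / 2) + 1 = 2 * j + 1 := by omega
        exact (congrArg r h).symm.le.trans (hleβ _)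
  have hsign : ∀ j, (∀ u ∈ Set.Ioo (α j) (β j), 0 < ∑ i, chiInt (s i) (t i) u) ∨
      (∀ u ∈ Set.Ioo (α j) (β j), ∑ i, chiInt (s i) (t i) u < 0) := by
    intro j
    by_cases hj : j < n
    · have hval : ∀ u ∈ Set.Ioo (α j) (β j), ∃ k, ∑ i, chiInt (s i) (t i) u = (W k : ℝ) ∧
          (k = 2 * j + 1 ∨ (k = 2 * j + 2 ∧ W k ≠ 0)) := by
        intro u ⟨hu1, hu2⟩
        obtain ⟨k, hk, h1, h2, h3⟩ := hΞ u
        refine ⟨k, h3, ?_⟩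
        rw [hα] at hu1
        have hk1 : 2 * j + 1 ≤ k := by
          by_contra! h
          exact lt_asymm hu1 (h2 (2 * j) (by omega) (by omega))
        rw [hβ] at hu2
        split_ifs at hu2 with hc
        · have : k ≤ 2 * j + 2 := by
            by_contra! h
            exact absurd (h1 (2 * j + 2) h) (not_le.mpr hu2)
          rcases (by omega : k = 2 * j + 1 ∨ k = 2 * j + 2) with h | h
          · exact Or.inl h
          · exact Or.inr ⟨h, h ▸ hc.2⟩
        · have : k ≤ 2 * j + 1 := by
            by_contra! h
            exact absurd (h1 (2 * j + 1) h) (not_le.mpr hu2)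
          exact Or.inl (by omega)
      have ho := hodd (2 * j + 1) (by omega)
      have hst : W (2 * j + 2) = W (2 * j + 1) + ε (2 * j + 1) := hWs _
      have hs1 := hε (2 * j + 1) (by omega)
      rcases lt_or_gt_of_ne (show W (2 * j + 1) ≠ 0 by omega) with hneg | hpos
      · refine Or.inr fun u hu => ?_
        obtain ⟨k, hk, h⟩ := hval u hu
        rw [hk, Int.cast_lt_zero]
        rcases h with rfl | ⟨rfl, h⟩ <;> omega
      · refine Or.inl fun u hu => ?_
        obtain ⟨k, hk, h⟩ := hval u hu
        rw [hk, Int.cast_pos]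
        rcases h with rfl | ⟨rfl, h⟩ <;> omega
    · refine Or.inl fun u hu => ?_
      have hne := hu.1.trans hu.2
      rw [hα, hβ, if_neg fun h => hj h.1, hdeg j (by omega)] at hne
      exact absurd hne (lt_irrefl _)
  obtain ⟨e, he, hcen, hsel⟩ := exists_strictMono_selection n α β hαβ hβα fun i j hi hij => by
    rw [hα, hα]; exact hpad i j hi hij
  refine ⟨fun j => α (e j), fun j => β (e j), fun j => hαβ _, ?_, hcen, ?_,
    fun j => hsign _, ?_, ?_⟩
  · rintro i j hij u ⟨⟨h1, h2⟩, h3, h4⟩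
    simp only [Set.mem_insert_iff, Set.mem_singleton_iff]
    rcases lt_or_gt_of_ne hij with h | h
    · exact Or.inr (le_antisymm h2 ((hβα _ _ (he i j h)).trans h3))
    · exact Or.inl (le_antisymm (h4.trans (hβα _ _ (he j i h))) h1)
  · intro u hu
    obtain ⟨k, hk, h1, h2, h3⟩ := hΞ u
    rw [h3, Int.cast_ne_zero] at hu
    obtain ⟨j, hj, hjk, hk2, ha, hb⟩ := hcover k hk hu
    have hl := ha.trans (h1 (k - 1) (by omega))
    have hr' := (h2 k le_rfl hk2).trans_le hb
    obtain ⟨j', rfl⟩ := hsel j hj (hl.trans_lt hr')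
    exact Set.mem_iUnion.mpr ⟨j', hl, hr'.le⟩
  · intro j u hu
    refine ⟨?_, habs u⟩
    obtain ⟨k, -, -, -, h3⟩ := hΞ u
    have h0 : ∑ i, chiInt (s i) (t i) u ≠ 0 := by
      rcases hsign (e j) with h | h
      exacts [(h u hu).ne', (h u hu).ne]
    rw [h3, Int.cast_ne_zero] at h0
    rw [h3]
    exact_mod_cast Int.one_le_abs h0
  · obtain ⟨L, hL, hcard⟩ := exists_card_le_ne A B hperm
    have hR' : (0 : ℝ) < R := by exact_mod_cast hR
    have hc0 : 0 < c₀ / R := by positivity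
    have hLI : L ∈ 𝓘 := by
      rcases hL with ⟨i, rfl⟩ | ⟨i, rfl⟩
      exacts [hA i, hB i]
    have hthr : ∀ ℓ ∈ 𝓘, ∀ x ∈ Set.Icc ((ℓ : ℝ) / R) ((ℓ + 1 : ℝ) / R),
        (x ≤ (L + 1 : ℝ) / R ↔ ℓ ≤ L) := by
      intro ℓ hℓ x hx
      constructor
      · intro h
        by_contra! hlt
        have h1 : (L + 1 : ℝ) / R ≤ ℓ / R := by gcongr; exact_mod_cast hlt
        have h2 : (L + 1 : ℝ) / R = x := le_antisymm (h1.trans hx.1) h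
        have h3 := hsep L hLI ℓ hℓ hlt.ne ((L + 1 : ℝ) / R) ⟨by gcongr; linarith, le_rfl⟩ x hx
        rw [h2, sub_self, abs_zero] at h3
        linarith
      · intro h
        refine hx.2.trans ?_
        gcongr
    have hmem : ∀ k < 2 * n, ∃ ℓ ∈ 𝓘, r k ∈ Set.Icc ((ℓ : ℝ) / R) ((ℓ + 1 : ℝ) / R) := by
      intro k hk
      rcases hrng k hk with ⟨i, h⟩ | ⟨i, h⟩
      · exact ⟨B i, hB i, h ▸ hs i⟩
      · exact ⟨A i, hA i, h ▸ ht i⟩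
    obtain ⟨k, hk, h1, h2, h3⟩ := hΞ ((L + 1 : ℝ) / R)
    have hk0 : W k ≠ 0 := by
      intro h0
      rw [h0] at h3
      simp only [chiInt_eq_sub, fun i => hthr _ (hB i) _ (hs i), fun i => hthr _ (hA i) _ (ht i)]
        at h3
      rw [← Int.cast_sum, Int.cast_inj, Finset.sum_sub_distrib, Finset.sum_boole,
        Finset.sum_boole] at h3
      apply hcard
      have := sub_eq_zero.mp h3
      exact_mod_cast this.symm
    obtain ⟨j, hj, hjk, hk2, ha, hb⟩ := hcover k hk hk0
    obtain ⟨ℓ, hℓ, hx⟩ := hmem (k - 1) (by omega)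
    obtain ⟨ℓ', hℓ', hy⟩ := hmem k hk2
    have h4 := h1 (k - 1) (by omega)
    have h5 := h2 k le_rfl hk2
    have hne : ℓ ≠ ℓ' := by
      rintro rfl
      exact absurd ((hthr ℓ hℓ _ hy).mpr ((hthr ℓ hℓ _ hx).mp h4)) (not_le.mpr h5)
    have hlen := hsep ℓ hℓ ℓ' hℓ' hne _ hx _ hy
    rw [abs_sub_comm, abs_of_pos (by linarith)] at hlen
    obtain ⟨j', rfl⟩ := hsel j hj (by linarith)
    refine ⟨j', ?_⟩
    have hdiv : c₀ / n / R ≤ c₀ / R := by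
      gcongr
      exact div_le_self (by linarith) (by exact_mod_cast hn)
    linarith
end
end
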